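/- arXiv:1706.05711 — 7 statements merged into one kernel-verified Lean document; each statement's English description precedes it below -/
import Mathlib

section
/- Every element of the interval-point set P_t is either of the form j·D or M − j·D for some integer j with 0 ≤ j ≤ T − t, or of the form pos(a,t′) + j·D + s for some target a ∈ {1,…,N}, some time t′ with t ≤ t′ ≤ T, some integer j with |j| ≤ t′ − t, and some s ∈ {−R, R + ε}. -/
/-- Interval points contributed at time `t`: the boundary points `0` and `M`
together with, for each target `a ∈ {1,…,N}`, the points `pos a t - R`
(if it lies in `(0,M)`) and `pos a t + R + ε` (if `pos a t + R < M`). -/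
def basePoints (N : ℕ) (M R ε : ℝ) (pos : ℕ → ℕ → ℝ) (t : ℕ) : Set ℝ :=
  {0, M} ∪
    {x : ℝ | ∃ a : ℕ, 1 ≤ a ∧ a ≤ N ∧
      ((x = pos a t - R ∧ 0 < x ∧ x < M) ∨
       (x = pos a t + R + ε ∧ pos a t + R < M))}

/-- The points `p - D` and `p + D` (those lying in `(0,M)`) for `p ∈ S`. -/
def stepPoints (M D : ℝ) (S : Set ℝ) : Set ℝ :=
  {x : ℝ | (∃ p ∈ S, x = p - D ∨ x = p + D) ∧ 0 < x ∧ x < M}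

/-- Auxiliary recursion (backwards in time): `intervalPointsAux … k` is the
interval-point set at time `T - k`. -/
def intervalPointsAux (N : ℕ) (M D R ε : ℝ) (pos : ℕ → ℕ → ℝ) (T : ℕ) : ℕ → Set ℝ
  | 0 => basePoints N M R ε pos T
  | k + 1 =>
      basePoints N M R ε pos (T - (k + 1)) ∪
        stepPoints M D (intervalPointsAux N M D R ε pos T k)

/-- The interval-point set `P t` produced by Algorithm 1:
`P T = basePoints T` and, for `t < T`,
`P t = basePoints t ∪ {p ± D ∈ (0,M) | p ∈ P (t+1)}`. -/
def intervalPoints (N : ℕ) (M D R ε : ℝ) (pos : ℕ → ℕ → ℝ) (T t : ℕ) : Set ℝ :=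
  intervalPointsAux N M D R ε pos T (T - t)

theorem mem_basePoints_form {N : ℕ} {M R ε : ℝ} {pos : ℕ → ℕ → ℝ} {t : ℕ} {x : ℝ}
    (hx : x ∈ basePoints N M R ε pos t) :
    (x = 0 ∨ x = M) ∨
      ∃ a : ℕ, 1 ≤ a ∧ a ≤ N ∧ (x = pos a t - R ∨ x = pos a t + R + ε) := by
  rcases hx with hx | ⟨a, ha1, haN, ⟨hx, -⟩ | ⟨hx, -⟩⟩
  · exact Or.inl (by simpa using hx)
  · exact Or.inr ⟨a, ha1, haN, Or.inl hx⟩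
  · exact Or.inr ⟨a, ha1, haN, Or.inr hx⟩

theorem mem_intervalPointsAux_form {N : ℕ} {M D R ε : ℝ} {pos : ℕ → ℕ → ℝ} {T : ℕ}
    (hD : 0 ≤ D) (k : ℕ) (hk : k ≤ T) {x : ℝ}
    (hx : x ∈ intervalPointsAux N M D R ε pos T k) :
    (∃ j : ℕ, j ≤ k ∧ (x = j * D ∨ x = M - j * D)) ∨
    (∃ a t' : ℕ, 1 ≤ a ∧ a ≤ N ∧ T - k ≤ t' ∧ t' ≤ T ∧
      ∃ j : ℤ, |j| ≤ (t' : ℤ) - ((T - k : ℕ) : ℤ) ∧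
        (x = pos a t' + j * D - R ∨ x = pos a t' + j * D + R + ε)) := by
  have base : ∀ k ≤ T, ∀ x ∈ basePoints N M R ε pos (T - k),
      (∃ j : ℕ, j ≤ k ∧ (x = j * D ∨ x = M - j * D)) ∨
      (∃ a t' : ℕ, 1 ≤ a ∧ a ≤ N ∧ T - k ≤ t' ∧ t' ≤ T ∧
        ∃ j : ℤ, |j| ≤ (t' : ℤ) - ((T - k : ℕ) : ℤ) ∧
          (x = pos a t' + j * D - R ∨ x = pos a t' + j * D + R + ε)) := by
    intro k _ x hx
    rcases mem_basePoints_form hx with h | ⟨a, ha1, haN, h⟩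
    · exact Or.inl ⟨0, Nat.zero_le _, by simpa using h⟩
    · exact Or.inr ⟨a, T - k, ha1, haN, le_rfl, Nat.sub_le _ _, 0, by simp, by simpa using h⟩
  induction k generalizing x with
  | zero => exact base 0 hk x hx
  | succ k ih =>
    rcases hx with hx | ⟨⟨p, hp, hxp⟩, hx0, hxM⟩
    · exact base (k + 1) hk x hx
    rcases ih (by omega) hp with ⟨j, hj, h⟩ | ⟨a, t', ha1, haN, htt', ht'T, j, hj, h⟩
    · left
      rcases h with rfl | rfl <;> rcases hxp with rfl | rfl
      · rcases j with _ | j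
        · simp at hx0
          linarith
        · exact ⟨j, by omega, Or.inl (by push_cast; ring)⟩
      · exact ⟨j + 1, by omega, Or.inl (by push_cast; ring)⟩
      · exact ⟨j + 1, by omega, Or.inr (by push_cast; ring)⟩
      · rcases j with _ | j
        · simp at hxM
          linarith
        · exact ⟨j, by omega, Or.inr (by push_cast; ring)⟩
    · right
      refine ⟨a, t', ha1, haN, by omega, ht'T, ?_⟩
      rw [abs_le] at hj
      rcases hxp with rfl | rfl
      · refine ⟨j - 1, abs_le.2 (by omega), h.imp ?_ ?_⟩ <;>
          rintro rfl <;> push_cast <;> ring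
      · refine ⟨j + 1, abs_le.2 (by omega), h.imp ?_ ?_⟩ <;>
          rintro rfl <;> push_cast <;> ring

/-- Every element of the interval-point set `P t` is either of the
form `j·D` or `M − j·D` for some integer `0 ≤ j ≤ T − t`, or of the form
`pos(a,t′) + j·D + s` for some target `a ∈ {1,…,N}`, some time `t ≤ t′ ≤ T`,
some integer `j` with `|j| ≤ t′ − t` and some `s ∈ {−R, R + ε}`. -/
theorem interval_points_form
    (N T M D : ℕ) (R ε : ℝ) (pos : ℕ → ℕ → ℝ)
    (hR : 0 ≤ R) (hε : 0 < ε)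
    (hpos : ∀ a t', 1 ≤ a → a ≤ N → 1 ≤ t' → t' ≤ T →
      0 ≤ pos a t' ∧ pos a t' ≤ (M : ℝ))
    (t : ℕ) (ht1 : 1 ≤ t) (ht2 : t ≤ T)
    (x : ℝ) (hx : x ∈ intervalPoints N (M : ℝ) (D : ℝ) R ε pos T t) :
    (∃ j : ℕ, j ≤ T - t ∧
      (x = (j : ℝ) * (D : ℝ) ∨ x = (M : ℝ) - (j : ℝ) * (D : ℝ))) ∨
    (∃ a t' : ℕ, 1 ≤ a ∧ a ≤ N ∧ t ≤ t' ∧ t' ≤ T ∧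
      ∃ j : ℤ, |j| ≤ (t' : ℤ) - (t : ℤ) ∧
        (x = pos a t' + (j : ℝ) * (D : ℝ) - R ∨
         x = pos a t' + (j : ℝ) * (D : ℝ) + R + ε)) := by
  have h := mem_intervalPointsAux_form D.cast_nonneg (T - t) (Nat.sub_le T t) hx
  rwa [Nat.sub_sub_self ht2] at h
end

section
/- Fix a time t and a target a, and suppose ε is small enough that no integer lies in the open interval (pos(a,t) + R, pos(a,t) + R + ε). If x and y are integer patrol positions in [0,M] lying in the same interval at time t (i.e., in the same half-open interval [p, p′) between consecutive elements of P_t), then |pos(a,t) − x| ≤ R if and only if |pos(a,t) − y| ≤ R. Consequently, two patrols located in the same interval at time t protect exactly the same set of targets at time t. -/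
theorem basePoints_subset_intervalPoints (N : ℕ) (M D R ε : ℝ) (pos : ℕ → ℕ → ℝ)
    {T t : ℕ} (ht : t ≤ T) :
    basePoints N M R ε pos t ⊆ intervalPoints N M D R ε pos T t := by
  obtain ⟨k, rfl⟩ := Nat.exists_eq_add_of_le ht
  unfold intervalPoints
  rw [Nat.add_sub_cancel_left]
  cases k with
  | zero => exact subset_rfl
  | succ k =>
    intro q hq
    left
    rwa [Nat.add_sub_cancel]

/-- If no base point separates `x` from `y`, protection of the target `a` at `x` passes to `y`. -/
theorem abs_sub_le_of_no_basePoints_between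
    {N : ℕ} {M R ε : ℝ} {pos : ℕ → ℕ → ℝ} {t a : ℕ} (ha1 : 1 ≤ a) (ha2 : a ≤ N)
    (hsmall : ∀ z : ℤ, ¬(pos a t + R < (z : ℝ) ∧ (z : ℝ) < pos a t + R + ε)) (hε : 0 < ε)
    {x y : ℤ} (hxM : (x : ℝ) ≤ M) (hy0 : 0 ≤ y) (hyM : (y : ℝ) ≤ M)
    (hyx : ∀ q ∈ basePoints N M R ε pos t, ¬((y : ℝ) < q ∧ q ≤ x))
    (hxy : ∀ q ∈ basePoints N M R ε pos t, ¬((x : ℝ) < q ∧ q ≤ y))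
    (h : |pos a t - (x : ℝ)| ≤ R) : |pos a t - (y : ℝ)| ≤ R := by
  have hy0' : (0 : ℝ) ≤ y := by exact_mod_cast hy0
  rw [abs_le] at h ⊢
  constructor
  · by_contra! hlt
    refine hxy (pos a t + R + ε) (Or.inr ⟨a, ha1, ha2, Or.inr ⟨rfl, by linarith⟩⟩)
      ⟨by linarith, ?_⟩
    by_contra! hy
    exact hsmall y ⟨by linarith, hy⟩
  · by_contra! hlt
    rcases lt_or_ge (pos a t - R) M with hM | hM
    · exact hyx (pos a t - R) (Or.inr ⟨a, ha1, ha2, Or.inl ⟨rfl, by linarith, hM⟩⟩)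
        ⟨by linarith, by linarith⟩
    · have hxM' : (x : ℝ) = M := by linarith
      exact hyx M (Or.inl (Or.inr rfl)) ⟨by linarith, hxM'.ge⟩

/-- Fix a time `t` and a target `a`, and suppose `ε` is small
enough that no integer lies in `(pos a t + R, pos a t + R + ε)`.  If `x` and `y`
are integer patrol positions in `[0,M]` lying in the same interval at time `t`
(i.e. in the same half-open interval `[p, p′)` between consecutive elements of
`P t`), then `|pos a t − x| ≤ R ↔ |pos a t − y| ≤ R`; consequently two patrols
located in the same interval protect exactly the same set of targets. -/
theorem same_interval_same_protection
    (N T M D : ℕ) (R ε : ℝ) (pos : ℕ → ℕ → ℝ)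
    (hR : 0 ≤ R) (hε : 0 < ε)
    (hpos : ∀ b t', 1 ≤ b → b ≤ N → 1 ≤ t' → t' ≤ T →
      0 ≤ pos b t' ∧ pos b t' ≤ (M : ℝ))
    (t a : ℕ) (ht1 : 1 ≤ t) (ht2 : t ≤ T) (ha1 : 1 ≤ a) (ha2 : a ≤ N)
    (hsmall : ∀ z : ℤ, ¬(pos a t + R < (z : ℝ) ∧ (z : ℝ) < pos a t + R + ε))
    (p p' : ℝ)
    (hp : p ∈ intervalPoints N (M : ℝ) (D : ℝ) R ε pos T t)
    (hp' : p' ∈ intervalPoints N (M : ℝ) (D : ℝ) R ε pos T t)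
    (hpp' : p < p')
    (hconsec : ∀ q ∈ intervalPoints N (M : ℝ) (D : ℝ) R ε pos T t, ¬(p < q ∧ q < p'))
    (x y : ℤ)
    (hx0 : 0 ≤ x) (hxM : (x : ℝ) ≤ (M : ℝ)) (hxp : p ≤ (x : ℝ)) (hxp' : (x : ℝ) < p')
    (hy0 : 0 ≤ y) (hyM : (y : ℝ) ≤ (M : ℝ)) (hyp : p ≤ (y : ℝ)) (hyp' : (y : ℝ) < p') :
    (|pos a t - (x : ℝ)| ≤ R ↔ |pos a t - (y : ℝ)| ≤ R) := by
  have key : ∀ u v : ℤ, p ≤ (u : ℝ) → (v : ℝ) < p' →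
      ∀ q ∈ basePoints N (M : ℝ) R ε pos t, ¬((u : ℝ) < q ∧ q ≤ v) :=
    fun u v hu hv q hq h =>
      hconsec q (basePoints_subset_intervalPoints N M D R ε pos ht2 hq)
        ⟨hu.trans_lt h.1, h.2.trans_lt hv⟩
  exact ⟨abs_sub_le_of_no_basePoints_between ha1 ha2 hsmall hε hxM hy0 hyM
      (key y x hyp hxp') (key x y hxp hyp'),
    abs_sub_le_of_no_basePoints_between ha1 ha2 hsmall hε hyM hx0 hxM
      (key x y hxp hyp') (key y x hyp hxp')⟩
end

section
/- Let [s, f) be an interval at time t and [s′, f′) an interval at time t+1 (so by the construction of P_t, the points s′ − D and f′ + D belong to P_t whenever they lie in (0,M)). If there exist integers x ∈ [s, f) ∩ [0,M] and y ∈ [s′, f′) ∩ [0,M] with |x − y| ≤ D, then for every integer x′ ∈ [s, f) ∩ [0,M] there exists an integer y′ ∈ [s′, f′) ∩ [0,M] with |x′ − y′| ≤ D; that is, if some position in the first interval has a feasible move into the second interval, then every position in the first interval does. -/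
theorem right_mem_intervalPoints (N : ℕ) (M D R ε : ℝ) (pos : ℕ → ℕ → ℝ) (T t : ℕ) :
    M ∈ intervalPoints N M D R ε pos T t := by
  unfold intervalPoints
  cases T - t <;> simp [intervalPointsAux, basePoints]

theorem mem_intervalPoints_of_mem_succ {N : ℕ} {M D R ε : ℝ} {pos : ℕ → ℕ → ℝ} {T t : ℕ}
    (ht : t + 1 ≤ T) {p x : ℝ} (hp : p ∈ intervalPoints N M D R ε pos T (t + 1))
    (hx : x = p - D ∨ x = p + D) (hx0 : 0 < x) (hxM : x ≤ M) :
    x ∈ intervalPoints N M D R ε pos T t := by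
  rcases hxM.eq_or_lt with rfl | hlt
  · exact right_mem_intervalPoints ..
  · have h : T - t = (T - (t + 1)) + 1 := by omega
    unfold intervalPoints
    rw [h]
    exact Or.inr ⟨⟨p, hp, hx⟩, hx0, hlt⟩

/-- Let `[s, f)` be an interval at time `t` and `[s′, f′)` an
interval at time `t+1` (consecutive interval points of `P t`, resp. `P (t+1)`).
If some integer position of `[s, f) ∩ [0,M]` has a feasible move (of length at
most `D`) into an integer position of `[s′, f′) ∩ [0,M]`, then every integer
position of `[s, f) ∩ [0,M]` has such a feasible move into `[s′, f′) ∩ [0,M]`. -/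
theorem feasible_move_between_intervals
    (N T M D : ℕ) (R ε : ℝ) (pos : ℕ → ℕ → ℝ)
    (hR : 0 ≤ R) (hε : 0 < ε)
    (hpos : ∀ b t', 1 ≤ b → b ≤ N → 1 ≤ t' → t' ≤ T →
      0 ≤ pos b t' ∧ pos b t' ≤ (M : ℝ))
    (t : ℕ) (ht1 : 1 ≤ t) (ht2 : t + 1 ≤ T)
    (s f : ℝ)
    (hs : s ∈ intervalPoints N (M : ℝ) (D : ℝ) R ε pos T t)
    (hf : f ∈ intervalPoints N (M : ℝ) (D : ℝ) R ε pos T t)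
    (hsf : s < f)
    (hconsec : ∀ q ∈ intervalPoints N (M : ℝ) (D : ℝ) R ε pos T t, ¬(s < q ∧ q < f))
    (s' f' : ℝ)
    (hs' : s' ∈ intervalPoints N (M : ℝ) (D : ℝ) R ε pos T (t + 1))
    (hf' : f' ∈ intervalPoints N (M : ℝ) (D : ℝ) R ε pos T (t + 1))
    (hs'f' : s' < f')
    (hconsec' : ∀ q ∈ intervalPoints N (M : ℝ) (D : ℝ) R ε pos T (t + 1),
      ¬(s' < q ∧ q < f'))
    (hex : ∃ x y : ℤ,
      (s ≤ (x : ℝ) ∧ (x : ℝ) < f ∧ 0 ≤ x ∧ (x : ℝ) ≤ (M : ℝ)) ∧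
      (s' ≤ (y : ℝ) ∧ (y : ℝ) < f' ∧ 0 ≤ y ∧ (y : ℝ) ≤ (M : ℝ)) ∧
      |x - y| ≤ (D : ℤ)) :
    ∀ x' : ℤ, s ≤ (x' : ℝ) → (x' : ℝ) < f → 0 ≤ x' → (x' : ℝ) ≤ (M : ℝ) →
      ∃ y' : ℤ, s' ≤ (y' : ℝ) ∧ (y' : ℝ) < f' ∧ 0 ≤ y' ∧ (y' : ℝ) ≤ (M : ℝ) ∧
        |x' - y'| ≤ (D : ℤ) := by
  obtain ⟨x, y, ⟨hsx, hxf, hx0, hxM⟩, ⟨hsy, hyf, hy0, hyM⟩, hxy⟩ := hex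
  intro x' hsx' hxf' hx0' hxM'
  obtain ⟨hxy₁, hxy₂⟩ := abs_le.mp hxy
  have hx0R : (0 : ℝ) ≤ x := by exact_mod_cast hx0
  have hx0R' : (0 : ℝ) ≤ x' := by exact_mod_cast hx0'
  have hyx : (y : ℝ) ≤ x + D := by
    have : y ≤ x + D := by omega
    exact_mod_cast this
  have hxy' : (x : ℝ) - D ≤ y := by
    have : x - D ≤ y := by omega
    exact_mod_cast this
  rcases lt_or_ge (x' + D) y with hlt | hge
  · have hltR : (x' : ℝ) + D < y := by exact_mod_cast hlt
    refine ⟨x' + D, ?_, ?_, by omega, ?_, by simp⟩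
    · push_cast
      by_contra! hcon
      exact hconsec (s' - D)
        (mem_intervalPoints_of_mem_succ ht2 hs' (Or.inl rfl) (by linarith) (by linarith))
        ⟨by linarith, by linarith⟩
    · push_cast
      linarith
    · push_cast
      linarith
  rcases lt_or_ge y (x' - D) with hlt | hge'
  · have hltR : (y : ℝ) < x' - D := by exact_mod_cast hlt
    have hD : (0 : ℝ) ≤ D := D.cast_nonneg
    refine ⟨x' - D, ?_, ?_, by omega, ?_, by simp⟩
    · push_cast
      linarith
    · push_cast
      by_contra! hcon
      exact hconsec (f' + D)
        (mem_intervalPoints_of_mem_succ ht2 hf' (Or.inr rfl) (by linarith) (by linarith))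
        ⟨by linarith, by linarith⟩
    · push_cast
      linarith
  exact ⟨y, hsy, hyf, hy0, hyM, abs_le.mpr ⟨by omega, by omega⟩⟩
end

section
/- Let A_1, …, A_K and B_1, …, B_K be nonempty sets of real numbers such that for all i < i′, either A_i = A_{i′} or every element of A_i is less than every element of A_{i′}, and likewise for the B's. Let D ≥ 0 and say index i is feasible to index j if there exist x ∈ A_i and y ∈ B_j with |x − y| ≤ D. If there exists a permutation π of {1,…,K} such that i is feasible to π(i) for every i, then i is feasible to i for every i. In game terms: if two sorted pure snapshots at times t and t+1 occur together in a valid pure strategy, then for every j ∈ {1,…,K} the j-th interval of the snapshot at time t+1 lies in the feasible set of the j-th interval of the snapshot at time t. -/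
/-- A permutation of a finite linear order sends some element weakly below `i` weakly above `i`. -/
theorem Equiv.Perm.exists_le_and_le_apply {α : Type*} [Fintype α] [LinearOrder α]
    (π : Equiv.Perm α) (i : α) : ∃ a, a ≤ i ∧ i ≤ π a := by
  classical
  by_contra! h
  have hsub : ({a | a ≤ i} : Finset α).image π ⊂ ({a | a ≤ i} : Finset α) := by
    refine Finset.ssubset_iff_subset_ne.2 ⟨fun b hb => ?_, fun heq => ?_⟩
    · obtain ⟨a, ha, rfl⟩ := Finset.mem_image.1 hb
      simpa using (h a (by simpa using ha)).le
    · have hi : i ∈ ({a | a ≤ i} : Finset α).image π := by simp [heq]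
      obtain ⟨a, ha, hai⟩ := Finset.mem_image.1 hi
      exact (h a (by simpa using ha)).ne hai
  have hcard := Finset.card_lt_card hsub
  rw [Finset.card_image_of_injective _ π.injective] at hcard
  exact lt_irrefl _ hcard

/-- Let `A 1, …, A K` and `B 1, …, B K` be nonempty sets of
reals, each family sorted (any two sets are equal or elementwise strictly
ordered according to their indices), and let `D ≥ 0`.  If some permutation `π`
matches every `i` feasibly (there are `x ∈ A i`, `y ∈ B (π i)` with
`|x − y| ≤ D`), then the identity matching is feasible: for every `i` there are
`x ∈ A i`, `y ∈ B i` with `|x − y| ≤ D`.  In game terms: if two sorted pure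
snapshots at consecutive times occur together in a valid pure strategy, the
`j`-th interval at time `t+1` is in the feasible set of the `j`-th interval at
time `t`. -/
theorem sorted_snapshots_feasible
    (K : ℕ) (D : ℝ) (hD : 0 ≤ D)
    (A B : Fin K → Set ℝ)
    (hAne : ∀ i, (A i).Nonempty) (hBne : ∀ j, (B j).Nonempty)
    (hA : ∀ i i' : Fin K, i < i' → A i = A i' ∨ ∀ x ∈ A i, ∀ y ∈ A i', x < y)
    (hB : ∀ j j' : Fin K, j < j' → B j = B j' ∨ ∀ x ∈ B j, ∀ y ∈ B j', x < y)
    (hmatch : ∃ π : Equiv.Perm (Fin K), ∀ i, ∃ x ∈ A i, ∃ y ∈ B (π i), |x - y| ≤ D) :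
    ∀ i, ∃ x ∈ A i, ∃ y ∈ B i, |x - y| ≤ D := by
  obtain ⟨π, hπ⟩ := hmatch
  intro i
  obtain ⟨a, hai, hia⟩ := π.exists_le_and_le_apply i
  obtain ⟨b, hib, hbi⟩ : ∃ b, i ≤ b ∧ π b ≤ i := by
    obtain ⟨c, hci, hic⟩ := Equiv.Perm.exists_le_and_le_apply π.symm i
    exact ⟨π.symm c, hic, by simpa using hci⟩
  have le_cases {C : Fin K → Set ℝ}
      (hC : ∀ j j' : Fin K, j < j' → C j = C j' ∨ ∀ x ∈ C j, ∀ y ∈ C j', x < y)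
      {j j' : Fin K} (h : j ≤ j') : C j = C j' ∨ ∀ x ∈ C j, ∀ y ∈ C j', x < y := by
    rcases h.eq_or_lt with rfl | h
    · exact Or.inl rfl
    · exact hC _ _ h
  have abs_le_of {x y : ℝ} (h₁ : x - y ≤ D) (h₂ : y - x ≤ D) : |x - y| ≤ D :=
    abs_sub_le_iff.2 ⟨h₁, h₂⟩
  by_contra hcon
  have not_feasible : ∀ x ∈ A i, ∀ y ∈ B i, x - y ≤ D → y - x ≤ D → False :=
    fun x hx y hy h₁ h₂ => hcon ⟨x, hx, y, hy, abs_le_of h₁ h₂⟩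
  have upper : (∃ x ∈ A i, ∀ y ∈ B i, y - x ≤ D) ∨ ∃ y ∈ B i, ∀ x ∈ A i, y - x ≤ D := by
    obtain ⟨x, hx, y, hy, hxy⟩ := hπ a
    have hxy' := (abs_sub_le_iff.1 hxy).2
    rcases le_cases hA hai with hAa | hAa <;> rcases le_cases hB hia with hBa | hBa
    · exact (hcon ⟨x, hAa ▸ hx, y, hBa ▸ hy, hxy⟩).elim
    · exact Or.inl ⟨x, hAa ▸ hx, fun q hq => by linarith [hBa q hq y hy]⟩
    · exact Or.inr ⟨y, hBa ▸ hy, fun p hp => by linarith [hAa x hx p hp]⟩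
    · obtain ⟨p, hp⟩ := hAne i
      exact Or.inl ⟨p, hp, fun q hq => by linarith [hAa x hx p hp, hBa q hq y hy]⟩
  have lower : (∃ x ∈ A i, ∀ y ∈ B i, x - y ≤ D) ∨ ∃ y ∈ B i, ∀ x ∈ A i, x - y ≤ D := by
    obtain ⟨x, hx, y, hy, hxy⟩ := hπ b
    have hxy' := (abs_sub_le_iff.1 hxy).1
    rcases le_cases hA hib with hAb | hAb <;> rcases le_cases hB hbi with hBb | hBb
    · exact (hcon ⟨x, hAb ▸ hx, y, hBb ▸ hy, hxy⟩).elim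
    · exact Or.inl ⟨x, hAb ▸ hx, fun q hq => by linarith [hBb y hy q hq]⟩
    · exact Or.inr ⟨y, hBb ▸ hy, fun p hp => by linarith [hAb p hp x hx]⟩
    · obtain ⟨p, hp⟩ := hAne i
      exact Or.inl ⟨p, hp, fun q hq => by linarith [hAb p hp x hx, hBb y hy q hq]⟩
  rcases upper with ⟨x, hx, hxq⟩ | ⟨y, hy, hyp⟩ <;>
    rcases lower with ⟨x', hx', hxq'⟩ | ⟨y', hy', hyp'⟩
  · obtain ⟨p, hp, q, hq, hpq⟩ := hπ (π.symm i)
    rw [π.apply_symm_apply] at hq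
    obtain ⟨h₁, h₂⟩ := abs_sub_le_iff.1 hpq
    rcases le_total (π.symm i) i with hj | hj <;> rcases le_cases hA hj with hAj | hAj
    · exact hcon ⟨p, hAj ▸ hp, q, hq, hpq⟩
    · exact not_feasible x' hx' q hq (hxq' q hq) (by linarith [hAj p hp x' hx'])
    · exact hcon ⟨p, hAj ▸ hp, q, hq, hpq⟩
    · exact not_feasible x hx q hq (by linarith [hAj x hx p hp]) (hxq q hq)
  · exact not_feasible x hx y' hy' (hyp' x hx) (hxq y' hy')
  · exact not_feasible x' hx' y hy (hxq' y hy) (hyp x' hx')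
  · obtain ⟨p, hp, q, hq, hpq⟩ := hπ i
    obtain ⟨h₁, h₂⟩ := abs_sub_le_iff.1 hpq
    rcases le_total (π i) i with hj | hj <;> rcases le_cases hB hj with hBj | hBj
    · exact hcon ⟨p, hp, q, hBj ▸ hq, hpq⟩
    · exact not_feasible p hp y hy (by linarith [hBj q hq y hy]) (hyp p hp)
    · exact hcon ⟨p, hp, q, hBj ▸ hq, hpq⟩
    · exact not_feasible p hp y' hy' (hyp' p hp) (by linarith [hBj y' hy' q hq])
end

section
/- Let m_1, …, m_K : {1,…,T} → ℤ be K patrol paths, i.e., |m_k(t+1) − m_k(t)| ≤ D for all k and all t < T. For each time t let n_1(t) ≤ … ≤ n_K(t) be the values m_1(t), …, m_K(t) sorted in nondecreasing order. Then: (i) each n_i is again a patrol path, i.e., |n_i(t+1) − n_i(t)| ≤ D for all t < T; (ii) for each t the multiset {n_1(t), …, n_K(t)} equals {m_1(t), …, m_K(t)}; (iii) the sorted paths are non-crossing: n_i(t) ≤ n_j(t) for all i ≤ j and all t; and (iv) for every target a and time t, some n_i(t) satisfies |pos(a,t) − n_i(t)| ≤ R iff some m_k(t) does, so the sorted pure strategy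 protects exactly the same target–time pairs. Hence every pure strategy of the defender can be replaced by a non-crossing pure strategy protecting the same targets, and in particular there exists an optimal mixed strategy all of whose pure strategies are non-crossing. -/
theorem Fin.exists_le_le_perm {K : ℕ} (π : Equiv.Perm (Fin K)) (i : Fin K) :
    ∃ j ≤ i, i ≤ π j := by
  by_contra! h
  have hcard := Finset.card_le_card_of_injOn (s := Finset.Iic i) (t := Finset.Iio i) π
    (fun j hj => by simpa using h j (by simpa using hj)) π.injective.injOn
  simp at hcard

/-- Sorting preserves a uniform pointwise bound between two tuples. -/
theorem Tuple.comp_sort_le_comp_sort_add {K : ℕ} {α : Type*} [AddCommGroup α] [LinearOrder α]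
    [IsOrderedAddMonoid α] {f g : Fin K → α} {c : α} (h : ∀ k, f k ≤ g k + c) (i : Fin K) :
    f (Tuple.sort f i) ≤ g (Tuple.sort g i) + c := by
  obtain ⟨j, hji, hij⟩ := Fin.exists_le_le_perm ((Tuple.sort g).trans (Tuple.sort f).symm) i
  calc
    f (Tuple.sort f i) ≤ f (Tuple.sort f ((Tuple.sort f).symm (Tuple.sort g j))) :=
      Tuple.monotone_sort f hij
    _ = f (Tuple.sort g j) := by rw [Equiv.apply_symm_apply]
    _ ≤ g (Tuple.sort g j) + c := h _
    _ ≤ g (Tuple.sort g i) + c := by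
      have := Tuple.monotone_sort g hji
      simp only [Function.comp_apply] at this
      gcongr

/-- Given `K` patrol paths `m 1, …, m K` (integer positions,
speed limit `D` between consecutive time points of `{1,…,T}`), there is the
pointwise sorted family `n`, which satisfies: (i) each `n i` is again a patrol
path; (ii) at every time the multiset of positions is unchanged; (iii) the
sorted paths are non-crossing; (iv) at every time the same targets are
protected (within radius `R`).  Hence every pure strategy can be replaced by a
non-crossing pure strategy protecting the same target–time pairs. -/
theorem sort_patrol_paths
    (K T N D : ℕ) (R : ℝ) (hR : 0 ≤ R) (pos : ℕ → ℕ → ℝ)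
    (m : Fin K → ℕ → ℤ)
    (hm : ∀ k : Fin K, ∀ t, 1 ≤ t → t < T → |m k (t + 1) - m k t| ≤ (D : ℤ)) :
    ∃ n : Fin K → ℕ → ℤ,
      (∀ i : Fin K, ∀ t, 1 ≤ t → t < T → |n i (t + 1) - n i t| ≤ (D : ℤ)) ∧
      (∀ t, 1 ≤ t → t ≤ T →
        (Finset.univ.val.map fun i : Fin K => n i t) =
          (Finset.univ.val.map fun k : Fin K => m k t)) ∧
      (∀ i j : Fin K, i ≤ j → ∀ t, 1 ≤ t → t ≤ T → n i t ≤ n j t) ∧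
      (∀ a t, 1 ≤ a → a ≤ N → 1 ≤ t → t ≤ T →
        ((∃ i : Fin K, |pos a t - (n i t : ℝ)| ≤ R) ↔
         (∃ k : Fin K, |pos a t - (m k t : ℝ)| ≤ R))) := by
  refine ⟨fun i t => m (Tuple.sort (fun k => m k t) i) t, ?_, ?_, ?_, ?_⟩
  · intro i t h1 ht
    have hab := fun k => abs_le.mp (hm k t h1 ht)
    have hup := Tuple.comp_sort_le_comp_sort_add (f := fun k => m k (t + 1)) (g := fun k => m k t)
      (c := (D : ℤ)) (fun k => by have := (hab k).2; lia) i
    have hdown := Tuple.comp_sort_le_comp_sort_add (f := fun k => m k t)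
      (g := fun k => m k (t + 1)) (c := (D : ℤ)) (fun k => by have := (hab k).1; lia) i
    exact abs_le.mpr ⟨by lia, by lia⟩
  · intro t _ _
    simpa only [Multiset.map_map, Function.comp_def] using
      congrArg (Multiset.map fun k => m k t)
        (Multiset.map_univ_val_equiv (Tuple.sort fun k => m k t))
  · intro i j hij t _ _
    exact Tuple.monotone_sort (fun k => m k t) hij
  · intro a t _ _ _ _
    exact (Tuple.sort fun k => m k t).surjective.exists
      (p := fun k => |pos a t - (m k t : ℝ)| ≤ R) |>.symm
end

section
/- Fix a time t and a target a. Let J_1 ≤ J_2 ≤ J_3 ≤ J_4 be intervals at time t in nondecreasing order of position, each containing at least one integer of [0,M], with every element of J_1 strictly less than every element of J_2 and every element of J_3 strictly less than every element of J_4 (the configuration of a crossing edge pair (J_1 → J_4), (J_2 → J_3) of the day graph). Then c_t(J_1, J_3, a) + c_t(J_2, J_4, a) ≤ c_t(J_1, J_4, a) + c_t(J_2, J_3, a); i.e., replacing the crossing pair of edges by the uncrossed pair does not increase the total gap-indicator cost for any target. -/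
open scoped Classical

/-- Gap indicator `c_t(I, I', a)` for a pair of intervals `I = [s,f)` below
`I' = [s',f')`: it is `1` iff the target position `posat` lies (weakly) above
`I` and strictly below `I'` and no integer patrol position of
`(I ∪ I') ∩ [0,M]` is within the protection radius `R` of `posat`. -/
noncomputable def cMid (M : ℕ) (R posat : ℝ) (I I' : ℝ × ℝ) : ℝ :=
  if I.2 ≤ posat ∧ posat < I'.1 ∧
      ¬∃ z : ℤ, 0 ≤ (z : ℝ) ∧ (z : ℝ) ≤ (M : ℝ) ∧
        ((I.1 ≤ (z : ℝ) ∧ (z : ℝ) < I.2) ∨ (I'.1 ≤ (z : ℝ) ∧ (z : ℝ) < I'.2)) ∧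
        |posat - (z : ℝ)| ≤ R
  then 1 else 0

/-- Border gap indicator `c_t(∅, I', a)`. -/
noncomputable def cLeft (M : ℕ) (R posat : ℝ) (I' : ℝ × ℝ) : ℝ :=
  if posat < I'.1 ∧
      ¬∃ z : ℤ, 0 ≤ (z : ℝ) ∧ (z : ℝ) ≤ (M : ℝ) ∧
        I'.1 ≤ (z : ℝ) ∧ (z : ℝ) < I'.2 ∧ |posat - (z : ℝ)| ≤ R
  then 1 else 0

/-- Border gap indicator `c_t(I, ∅, a)`. -/
noncomputable def cRight (M : ℕ) (R posat : ℝ) (I : ℝ × ℝ) : ℝ :=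
  if I.2 ≤ posat ∧
      ¬∃ z : ℤ, 0 ≤ (z : ℝ) ∧ (z : ℝ) ≤ (M : ℝ) ∧
        I.1 ≤ (z : ℝ) ∧ (z : ℝ) < I.2 ∧ |posat - (z : ℝ)| ≤ R
  then 1 else 0

theorem ite_one_zero_le_of_imp {P Q : Prop} [Decidable P] [Decidable Q] (h : P → Q) :
    (if P then 1 else 0 : ℝ) ≤ if Q then 1 else 0 := by
  split_ifs <;> first | tauto | norm_num

theorem cMid_eq_cRight_mul_cLeft (M : ℕ) (R p : ℝ) (I I' : ℝ × ℝ) :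
    cMid M R p I I' = cRight M R p I * cLeft M R p I' := by
  unfold cMid cRight cLeft
  rw [ite_zero_mul_ite_zero, one_mul]
  refine if_congr ⟨?_, ?_⟩ rfl rfl
  · rintro ⟨h, h', hn⟩
    exact ⟨⟨h, fun ⟨z, h0, hM, hs, hf, hz⟩ => hn ⟨z, h0, hM, Or.inl ⟨hs, hf⟩, hz⟩⟩,
      h', fun ⟨z, h0, hM, hs, hf, hz⟩ => hn ⟨z, h0, hM, Or.inr ⟨hs, hf⟩, hz⟩⟩
  · rintro ⟨⟨h, hn⟩, h', hn'⟩
    refine ⟨h, h', ?_⟩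
    rintro ⟨z, h0, hM, ⟨hs, hf⟩ | ⟨hs, hf⟩, hz⟩
    · exact hn ⟨z, h0, hM, hs, hf, hz⟩
    · exact hn' ⟨z, h0, hM, hs, hf, hz⟩

theorem cRight_le_cRight {M : ℕ} {R p : ℝ} {I J : ℝ × ℝ} (hIJ : I.2 ≤ J.1)
    (hJ : ∃ z : ℤ, 0 ≤ (z : ℝ) ∧ (z : ℝ) ≤ (M : ℝ) ∧ J.1 ≤ (z : ℝ) ∧ (z : ℝ) < J.2) :
    cRight M R p J ≤ cRight M R p I := by
  obtain ⟨y, hy0, hyM, hys, hyf⟩ := hJ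
  unfold cRight
  refine ite_one_zero_le_of_imp ?_
  rintro ⟨h, hn⟩
  refine ⟨by linarith, ?_⟩
  rintro ⟨z, -, -, -, hzf, hz⟩
  refine hn ⟨y, hy0, hyM, hys, hyf, ?_⟩
  rw [abs_le] at hz ⊢
  constructor <;> linarith [hz.1, hz.2]

theorem cLeft_le_cLeft {M : ℕ} {R p : ℝ} {I J : ℝ × ℝ} (hIJ : I.2 ≤ J.1)
    (hI : ∃ z : ℤ, 0 ≤ (z : ℝ) ∧ (z : ℝ) ≤ (M : ℝ) ∧ I.1 ≤ (z : ℝ) ∧ (z : ℝ) < I.2) :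
    cLeft M R p I ≤ cLeft M R p J := by
  obtain ⟨y, hy0, hyM, hys, hyf⟩ := hI
  unfold cLeft
  refine ite_one_zero_le_of_imp ?_
  rintro ⟨h, hn⟩
  refine ⟨by linarith, ?_⟩
  rintro ⟨z, -, -, hzs, -, hz⟩
  refine hn ⟨y, hy0, hyM, hys, hyf, ?_⟩
  rw [abs_le] at hz ⊢
  constructor <;> linarith [hz.1, hz.2]

/-- For intervals `J1 ≤ J2 ≤ J3 ≤ J4` at time `t` (half-open,
within `[0,M)`, each containing an integer of `[0,M]`, with `J1` strictly below
`J2` and `J3` strictly below `J4` — the configuration of a crossing edge pair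
`(J1 → J4), (J2 → J3)` of the day graph), replacing the crossing pair by the
uncrossed pair does not increase the total gap-indicator cost for any target:
`c_t(J1,J3,a) + c_t(J2,J4,a) ≤ c_t(J1,J4,a) + c_t(J2,J3,a)`. -/
theorem uncross_cost
    (M : ℕ) (R : ℝ) (hR : 0 ≤ R) (posat : ℝ)
    (hposat : 0 ≤ posat ∧ posat ≤ (M : ℝ))
    (J1 J2 J3 J4 : ℝ × ℝ)
    (h1 : 0 ≤ J1.1 ∧ J1.1 < J1.2 ∧ J1.2 ≤ (M : ℝ))
    (h2 : 0 ≤ J2.1 ∧ J2.1 < J2.2 ∧ J2.2 ≤ (M : ℝ))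
    (h3 : 0 ≤ J3.1 ∧ J3.1 < J3.2 ∧ J3.2 ≤ (M : ℝ))
    (h4 : 0 ≤ J4.1 ∧ J4.1 < J4.2 ∧ J4.2 ≤ (M : ℝ))
    (hs12 : J1.1 ≤ J2.1) (hs23 : J2.1 ≤ J3.1) (hs34 : J3.1 ≤ J4.1)
    (hstrict12 : J1.2 ≤ J2.1) (hstrict34 : J3.2 ≤ J4.1)
    (hocc1 : ∃ z : ℤ, 0 ≤ (z : ℝ) ∧ (z : ℝ) ≤ (M : ℝ) ∧ J1.1 ≤ (z : ℝ) ∧ (z : ℝ) < J1.2)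
    (hocc2 : ∃ z : ℤ, 0 ≤ (z : ℝ) ∧ (z : ℝ) ≤ (M : ℝ) ∧ J2.1 ≤ (z : ℝ) ∧ (z : ℝ) < J2.2)
    (hocc3 : ∃ z : ℤ, 0 ≤ (z : ℝ) ∧ (z : ℝ) ≤ (M : ℝ) ∧ J3.1 ≤ (z : ℝ) ∧ (z : ℝ) < J3.2)
    (hocc4 : ∃ z : ℤ, 0 ≤ (z : ℝ) ∧ (z : ℝ) ≤ (M : ℝ) ∧ J4.1 ≤ (z : ℝ) ∧ (z : ℝ) < J4.2) :
    cMid M R posat J1 J3 + cMid M R posat J2 J4 ≤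
      cMid M R posat J1 J4 + cMid M R posat J2 J3 := by
  simp only [cMid_eq_cRight_mul_cLeft]
  have hR21 := cRight_le_cRight (R := R) (p := posat) hstrict12 hocc2
  have hL34 := cLeft_le_cLeft (R := R) (p := posat) hstrict34 hocc3
  linarith [mul_nonneg (sub_nonneg.2 hR21) (sub_nonneg.2 hL34)]
end

section
/- Let f be a flow on the day graph that has at least one crossing flow, and let (e, e′) be the minimum crossing flow of f with respect to the total order on crossing flows. Then every crossing flow of the flow f′ obtained from f by applying the ResolveCross operation to (e, e′) is strictly greater than (e, e′) in that total order. Consequently, iteratively resolving the minimum crossing flow terminates, after at most as many iterations as there are pairs of grid edges, in a flow with no crossing flows. -/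
/-- A grid edge of the day graph with `K` columns and `P` rows: a triple
`(x, y, y′)` with `1 ≤ x ≤ K − 1` and `1 ≤ y ≤ y′ ≤ P`, representing an edge
from vertex `(x, y)` to vertex `(x+1, y′)`. -/
def IsGridEdge (K P : ℕ) (e : ℕ × ℕ × ℕ) : Prop :=
  1 ≤ e.1 ∧ e.1 ≤ K - 1 ∧ 1 ≤ e.2.1 ∧ e.2.1 ≤ e.2.2 ∧ e.2.2 ≤ P

/-- Two edges `e = (x, y₁, y₂)` and `e′ = (x, y′₁, y′₂)` in the same column
with `y₁ < y′₁` cross iff `y₂ > y′₂`. -/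
def Crosses (e e' : ℕ × ℕ × ℕ) : Prop :=
  e.1 = e'.1 ∧ e.2.1 < e'.2.1 ∧ e'.2.2 < e.2.2

/-- A crossing flow of `f`: a pair of crossing grid edges both carrying
positive flow. -/
def IsCrossingFlow (K P : ℕ) (f : ℕ × ℕ × ℕ → ℝ)
    (c : (ℕ × ℕ × ℕ) × (ℕ × ℕ × ℕ)) : Prop :=
  IsGridEdge K P c.1 ∧ IsGridEdge K P c.2 ∧ Crosses c.1 c.2 ∧
    0 < f c.1 ∧ 0 < f c.2

/-- The total order on crossing flows: for `c = ((x,y₁,y₂), (x,y′₁,y′₂))` and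
`c′ = ((x̂,y₃,y₄), (x̂,y′₃,y′₄))`, declare `c < c′` iff `x < x̂`; or `x = x̂` and
`y₁ < y₃`; or additionally `y₁ = y₃` and `y₂ < y₄`; or additionally `y₂ = y₄`
and `y′₂ < y′₄`; or additionally `y′₂ = y′₄` and `y′₁ < y′₃`. -/
def CrossLt (c c' : (ℕ × ℕ × ℕ) × (ℕ × ℕ × ℕ)) : Prop :=
  c.1.1 < c'.1.1 ∨
    (c.1.1 = c'.1.1 ∧ (c.1.2.1 < c'.1.2.1 ∨
      (c.1.2.1 = c'.1.2.1 ∧ (c.1.2.2 < c'.1.2.2 ∨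
        (c.1.2.2 = c'.1.2.2 ∧ (c.2.2.2 < c'.2.2.2 ∨
          (c.2.2.2 = c'.2.2.2 ∧ c.2.2.1 < c'.2.2.1)))))))

/-- The `ResolveCross` operation on a crossing flow
`c = ((x,y₁,y₂), (x,y′₁,y′₂))`: with `f_m = min (f c.1) (f c.2)`, decrease the
flow on `c.1` and `c.2` by `f_m` and increase the flow on the uncrossed edges
`(x, y₁, y′₂)` and `(x, y′₁, y₂)` by `f_m`. -/
noncomputable def resolveCross (f : ℕ × ℕ × ℕ → ℝ)
    (c : (ℕ × ℕ × ℕ) × (ℕ × ℕ × ℕ)) : ℕ × ℕ × ℕ → ℝ :=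
  fun d =>
    f d - (if d = c.1 ∨ d = c.2 then min (f c.1) (f c.2) else 0)
        + (if d = (c.1.1, c.1.2.1, c.2.2.2) ∨ d = (c.1.1, c.2.2.1, c.1.2.2)
            then min (f c.1) (f c.2) else 0)

/-- The finite set of grid edges of the day graph. -/
def gridEdges (K P : ℕ) : Finset (ℕ × ℕ × ℕ) :=
  (Finset.Icc 1 (K - 1) ×ˢ Finset.Icc 1 P ×ˢ Finset.Icc 1 P).filter
    (fun e => e.2.1 ≤ e.2.2)

/-- The tuple `(x, y₁, y₂, y′₂, y′₁)` whose lexicographic order is `CrossLt`. -/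
def crossKey (c : (ℕ × ℕ × ℕ) × (ℕ × ℕ × ℕ)) : ℕ ×ₗ ℕ ×ₗ ℕ ×ₗ ℕ ×ₗ ℕ :=
  toLex (c.1.1, toLex (c.1.2.1, toLex (c.1.2.2, toLex (c.2.2.2, c.2.2.1))))

theorem crossLt_iff_crossKey_lt (c c' : (ℕ × ℕ × ℕ) × (ℕ × ℕ × ℕ)) :
    CrossLt c c' ↔ crossKey c < crossKey c' := by
  simp [CrossLt, crossKey, Prod.Lex.toLex_lt_toLex]

theorem IsCrossingFlow.eq_of_crossKey_eq {K P : ℕ} {f : ℕ × ℕ × ℕ → ℝ}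
    {c c' : (ℕ × ℕ × ℕ) × (ℕ × ℕ × ℕ)} (hc : IsCrossingFlow K P f c)
    (hc' : IsCrossingFlow K P f c') (h : crossKey c = crossKey c') : c = c' := by
  obtain ⟨⟨x, a, b⟩, x₂, a₂, b₂⟩ := c
  obtain ⟨⟨u, p, q⟩, u₂, p₂, q₂⟩ := c'
  obtain ⟨-, -, ⟨hx, -, -⟩, -⟩ := hc
  obtain ⟨-, -, ⟨hu, -, -⟩, -⟩ := hc'
  simp only [crossKey, EmbeddingLike.apply_eq_iff_eq, Prod.mk.injEq] at h hx hu ⊢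
  omega

theorem mem_gridEdges {K P : ℕ} {e : ℕ × ℕ × ℕ} : e ∈ gridEdges K P ↔ IsGridEdge K P e := by
  simp only [gridEdges, IsGridEdge, Finset.mem_filter, Finset.mem_product, Finset.mem_Icc]
  omega

theorem IsCrossingFlow.mem_product {K P : ℕ} {f : ℕ × ℕ × ℕ → ℝ}
    {c : (ℕ × ℕ × ℕ) × (ℕ × ℕ × ℕ)} (hc : IsCrossingFlow K P f c) :
    c ∈ gridEdges K P ×ˢ gridEdges K P :=
  Finset.mem_product.2 ⟨mem_gridEdges.2 hc.1, mem_gridEdges.2 hc.2.1⟩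

theorem exists_min_crossingFlow {K P : ℕ} {f : ℕ × ℕ × ℕ → ℝ}
    (h : ∃ c, IsCrossingFlow K P f c) :
    ∃ c, IsCrossingFlow K P f c ∧
      ∀ c', IsCrossingFlow K P f c' → c' = c ∨ CrossLt c c' := by
  classical
  obtain ⟨c₀, hc₀⟩ := h
  obtain ⟨c, hc, hmin⟩ := Finset.exists_min_image
    ((gridEdges K P ×ˢ gridEdges K P).filter (IsCrossingFlow K P f)) crossKey
    ⟨c₀, Finset.mem_filter.2 ⟨hc₀.mem_product, hc₀⟩⟩
  rw [Finset.mem_filter] at hc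
  refine ⟨c, hc.2, fun c' hc' => ?_⟩
  rcases (hmin c' (Finset.mem_filter.2 ⟨hc'.mem_product, hc'⟩)).eq_or_lt with h | h
  · exact .inl (hc.2.eq_of_crossKey_eq hc' h).symm
  · exact .inr ((crossLt_iff_crossKey_lt _ _).2 h)

/-- Resolving a crossing flow creates positive flow only on the two uncrossed edges. -/
theorem pos_or_eq_of_resolveCross_pos {f : ℕ × ℕ × ℕ → ℝ}
    {c : (ℕ × ℕ × ℕ) × (ℕ × ℕ × ℕ)} (h₁ : 0 < f c.1) (h₂ : 0 < f c.2) {d : ℕ × ℕ × ℕ}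
    (hd : 0 < resolveCross f c d) :
    0 < f d ∨ d = (c.1.1, c.1.2.1, c.2.2.2) ∨ d = (c.1.1, c.2.2.1, c.1.2.2) := by
  by_contra! h
  have hm := lt_min h₁ h₂
  simp only [resolveCross, h.2.1, h.2.2, or_self, if_false] at hd
  split_ifs at hd <;> linarith [h.1]

/-- Resolving a crossing flow removes all flow from one of its two edges. -/
theorem resolveCross_eq_zero {f : ℕ × ℕ × ℕ → ℝ} {c : (ℕ × ℕ × ℕ) × (ℕ × ℕ × ℕ)}
    (hc : Crosses c.1 c.2) : resolveCross f c c.1 = 0 ∨ resolveCross f c c.2 = 0 := by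
  obtain ⟨⟨x, a, b⟩, x₂, a₂, b₂⟩ := c
  obtain ⟨-, ha, hb⟩ := hc
  simp only at ha hb
  rcases min_choice (f (x, a, b)) (f (x₂, a₂, b₂)) with h | h
  · left
    simp [resolveCross, h, hb.ne', ha.ne]
  · right
    simp [resolveCross, h, hb.ne, ha.ne']

theorem crossLt_of_isCrossingFlow_resolveCross {K P : ℕ} {f : ℕ × ℕ × ℕ → ℝ}
    {c : (ℕ × ℕ × ℕ) × (ℕ × ℕ × ℕ)} (hc : IsCrossingFlow K P f c)
    (hmin : ∀ c', IsCrossingFlow K P f c' → c' = c ∨ CrossLt c c')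
    {c' : (ℕ × ℕ × ℕ) × (ℕ × ℕ × ℕ)} (hc' : IsCrossingFlow K P (resolveCross f c) c') :
    CrossLt c c' := by
  obtain ⟨g₁, g₂, hX, p₁, p₂⟩ := hc
  obtain ⟨g₁', g₂', hX', p₁', p₂'⟩ := hc'
  have hne : c' ≠ c := by
    rintro rfl
    rcases resolveCross_eq_zero (f := f) hX with h | h <;> linarith
  have q₁ := pos_or_eq_of_resolveCross_pos p₁ p₂ p₁'
  have q₂ := pos_or_eq_of_resolveCross_pos p₁ p₂ p₂'
  have old : 0 < f c'.1 → 0 < f c'.2 → CrossLt c c' := fun h₁ h₂ =>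
    (hmin c' ⟨g₁', g₂', hX', h₁, h₂⟩).resolve_left hne
  have left : 0 < f c'.1 → Crosses c'.1 c.2 → (c'.1, c.2) = c ∨ CrossLt c (c'.1, c.2) :=
    fun h₁ h₂ => hmin _ ⟨g₁', g₂, h₂, h₁, p₂⟩
  have right : 0 < f c'.2 → Crosses c.1 c'.2 → (c.1, c'.2) = c ∨ CrossLt c (c.1, c'.2) :=
    fun h₁ h₂ => hmin _ ⟨g₁, g₂', h₂, p₁, h₁⟩
  clear p₁' p₂' hmin hne g₁ g₂ g₁' g₂' p₁ p₂
  obtain ⟨⟨x, a, b⟩, x₂, a₂, b₂⟩ := c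
  obtain ⟨⟨u, p, q⟩, v, r, s⟩ := c'
  simp only [Crosses, CrossLt, Prod.mk.injEq] at *
  by_cases h₁ : 0 < f (u, p, q) <;> by_cases h₂ : 0 < f (v, r, s) <;>
    simp only [h₁, h₂, true_imp_iff, false_imp_iff, true_or, false_or] at * <;> omega

theorem exists_resolveCross_sequence (K P n : ℕ) (f : ℕ × ℕ × ℕ → ℝ)
    (s : Finset ((ℕ × ℕ × ℕ) × (ℕ × ℕ × ℕ))) (hn : s.card ≤ n)
    (hs : ∀ c, IsCrossingFlow K P f c → ∀ p ∈ gridEdges K P ×ˢ gridEdges K P,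
      p = c ∨ CrossLt c p → p ∈ s) :
    ∃ (g : ℕ → (ℕ × ℕ × ℕ → ℝ)) (nsteps : ℕ),
      g 0 = f ∧ nsteps ≤ n ∧
      (∀ i < nsteps, ∃ ci, IsCrossingFlow K P (g i) ci ∧
        (∀ c', IsCrossingFlow K P (g i) c' → c' = ci ∨ CrossLt ci c') ∧
        g (i + 1) = resolveCross (g i) ci) ∧
      (∀ c', ¬ IsCrossingFlow K P (g nsteps) c') := by
  induction n generalizing f s with
  | zero =>
    refine ⟨fun _ => f, 0, rfl, le_rfl, by simp, fun c' hc' => ?_⟩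
    have := hs c' hc' c' hc'.mem_product (.inl rfl)
    simp_all
  | succ n ih =>
    by_cases h : ∃ c, IsCrossingFlow K P f c
    · obtain ⟨c, hc, hmin⟩ := exists_min_crossingFlow h
      have hcs := hs c hc c hc.mem_product (.inl rfl)
      obtain ⟨g, k, hg, hk, hstep, hend⟩ := ih (resolveCross f c) (s.erase c)
        (by rw [Finset.card_erase_of_mem hcs]; omega)
        (fun c' hc' p hp hle => by
          have hlt := crossLt_of_isCrossingFlow_resolveCross hc hmin hc'
          have hcp : CrossLt c p := by
            rcases hle with rfl | hle
            · exact hlt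
            · rw [crossLt_iff_crossKey_lt] at *
              exact hlt.trans hle
          refine Finset.mem_erase.2 ⟨?_, hs c hc p hp (.inr hcp)⟩
          rintro rfl
          exact lt_irrefl _ ((crossLt_iff_crossKey_lt _ _).1 hcp))
      refine ⟨fun i => Nat.casesOn i f g, k + 1, rfl, by omega, fun i hi => ?_, hend⟩
      cases i with
      | zero => exact ⟨c, hc, hmin, hg⟩
      | succ i => exact hstep i (by omega)
    · push Not at h
      exact ⟨fun _ => f, 0, rfl, Nat.zero_le _, by simp, h⟩

/-- If `c` is the minimum crossing flow of `f` (with respect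
to the total order `CrossLt`), then every crossing flow of `resolveCross f c`
is strictly greater than `c`.  Consequently, iteratively resolving the minimum
crossing flow terminates, after at most as many iterations as there are pairs
of grid edges, in a flow with no crossing flows. -/
theorem resolve_crosses_terminates
    (K P : ℕ) (f : ℕ × ℕ × ℕ → ℝ) (hf : ∀ e, 0 ≤ f e)
    (c : (ℕ × ℕ × ℕ) × (ℕ × ℕ × ℕ))
    (hc : IsCrossingFlow K P f c)
    (hmin : ∀ c', IsCrossingFlow K P f c' → c' = c ∨ CrossLt c c') :
    (∀ c', IsCrossingFlow K P (resolveCross f c) c' → CrossLt c c') ∧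
    ∃ (g : ℕ → (ℕ × ℕ × ℕ → ℝ)) (nsteps : ℕ),
      g 0 = f ∧
      nsteps ≤ (gridEdges K P).card * (gridEdges K P).card ∧
      (∀ i < nsteps, ∃ ci, IsCrossingFlow K P (g i) ci ∧
        (∀ c', IsCrossingFlow K P (g i) c' → c' = ci ∨ CrossLt ci c') ∧
        g (i + 1) = resolveCross (g i) ci) ∧
      (∀ c', ¬ IsCrossingFlow K P (g nsteps) c') := by
  refine ⟨fun c' => crossLt_of_isCrossingFlow_resolveCross hc hmin, ?_⟩
  exact exists_resolveCross_sequence K P _ f (gridEdges K P ×ˢ gridEdges K P)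
    (Finset.card_product _ _).le (fun _ _ p hp _ => hp)
end
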